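/- There is no binary linear [836, 11, 416] code. Equivalently: every F₂-linear subspace C of F₂^836 of dimension 11 contains a nonzero codeword of Hamming weight at most 415. -/

import Mathlib

namespace Code836

/-- The space `F₂¹¹`. -/
abbrev V := Fin 11 → ZMod 2

/-- The sign `(-1)^a`. -/
def sg (a : ZMod 2) : ℤ := if a = 0 then 1 else -1

lemma sg_zero : sg 0 = 1 := by simp [sg]

lemma sg_add (a b : ZMod 2) : sg (a + b) = sg a * sg b := by
  revert a b; decide

/-- Walsh transform. -/
def hat (g : V → ℤ) (a : V) : ℤ := ∑ x, g x * sg (x ⬝ᵥ a)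

lemma sum_sg (x : V) : ∑ c : V, sg (x ⬝ᵥ c) = if x = 0 then 2048 else 0 := by
  split_ifs with h
  · subst h
    simp [sg_zero]
  · obtain ⟨j, hj⟩ : ∃ j, x j ≠ 0 := by
      by_contra! hc
      exact h (funext hc)
    have hj1 : x j = 1 := by
      revert hj; generalize x j = t; revert t; decide
    have key : ∑ c : V, sg (x ⬝ᵥ c) = ∑ c : V, sg (x ⬝ᵥ (c + Pi.single j 1)) := by
      generalize (Pi.single j (1 : ZMod 2) : V) = p
      symm
      apply Fintype.sum_equiv (Equiv.addRight p)
      intro c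
      rw [Equiv.coe_addRight]
    have h2 : ∀ c : V, sg (x ⬝ᵥ (c + Pi.single j 1)) = - sg (x ⬝ᵥ c) := by
      intro c
      rw [dotProduct_add, sg_add, dotProduct_single_one, hj1]
      simp [sg]
    simp only [h2, Finset.sum_neg_distrib] at key
    omega

lemma add_eq_zero_V (x y : V) : x + y = 0 ↔ x = y := by
  constructor
  · intro h
    funext j
    have := congrFun h j
    simp only [Pi.add_apply, Pi.zero_apply] at this
    revert this
    generalize x j = s; generalize y j = t
    revert s t; decide
  · rintro rfl
    funext j
    simp only [Pi.add_apply, Pi.zero_apply]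
    generalize x j = s
    revert s; decide

lemma hat_conv (g h : V → ℤ) (a : V) :
    ∑ b, hat g b * hat h (a + b) = 2048 * hat (fun x => g x * h x) a := by
  have h1 : ∀ b, hat g b * hat h (a + b) =
      ∑ x, ∑ y, g x * h y * sg (y ⬝ᵥ a) * sg ((x + y) ⬝ᵥ b) := by
    intro b
    unfold hat
    rw [Finset.sum_mul_sum]
    refine Finset.sum_congr rfl fun x _ => Finset.sum_congr rfl fun y _ => ?_
    rw [dotProduct_add, add_dotProduct, sg_add, sg_add]
    ring
  simp only [h1]
  rw [Finset.sum_comm]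
  unfold hat
  rw [Finset.mul_sum]
  refine Finset.sum_congr rfl fun x _ => ?_
  rw [Finset.sum_comm]
  simp only [← Finset.mul_sum, sum_sg, add_eq_zero_V]
  simp
  ring

lemma cube_sum (g : V → ℤ) (hg : ∀ c, 0 ≤ hat g c) : 0 ≤ ∑ x, g x ^ 3 := by
  have h1 : 0 ≤ ∑ a, hat g a * ∑ b, hat g b * hat g (a + b) :=
    Finset.sum_nonneg fun a _ => mul_nonneg (hg a)
      (Finset.sum_nonneg fun b _ => mul_nonneg (hg b) (hg _))
  have h2 : ∑ a, hat g a * ∑ b, hat g b * hat g (a + b) =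
      2048 * ∑ a, hat g a * hat (fun x => g x * g x) (0 + a) := by
    rw [Finset.mul_sum]
    refine Finset.sum_congr rfl fun a _ => ?_
    rw [hat_conv, zero_add]
    ring
  rw [h2, hat_conv] at h1
  have h3 : hat (fun x => g x * (g x * g x)) 0 = ∑ x, g x ^ 3 := by
    unfold hat
    refine Finset.sum_congr rfl fun x _ => ?_
    rw [dotProduct_zero, sg_zero]
    ring
  rw [h3] at h1
  omega

lemma cubic_bound (f : ℕ) : (13 - 32 * (f : ℤ)) ^ 3 ≤ 2197 - 9056 * f := by
  rcases f with _ | f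
  · norm_num
  · push_cast
    have : (0 : ℤ) ≤ f := by positivity
    nlinarith [mul_nonneg this this, mul_nonneg this (mul_nonneg this this)]

lemma cubic_bound0 (f : ℕ) : (141 - 32 * (f : ℤ)) ^ 3 ≤ 2803221 - 9056 * f := by
  have h : (0 : ℤ) ≤ f := by positivity
  have h2 : (0 : ℤ) ≤ 1899520 - 433152 * (f : ℤ) + 32768 * (f : ℤ) ^ 2 := by
    nlinarith [sq_nonneg ((f : ℤ) * 4 - 26)]
  nlinarith [mul_nonneg h h2]

lemma sg_sum (v : Fin 836 → ZMod 2) : ∑ i, sg (v i) = 836 - 2 * (hammingNorm v : ℤ) := by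
  have h : ∀ i, sg (v i) = 1 - 2 * (if v i ≠ 0 then 1 else 0) := by
    intro i
    unfold sg
    split_ifs <;> simp_all
  simp only [h, Finset.sum_sub_distrib, ← Finset.mul_sum, Finset.sum_boole]
  rw [Finset.sum_const, Finset.card_univ, Fintype.card_fin, hammingNorm, nsmul_eq_mul, mul_one]
  rfl

end Code836

open Code836 in
/-- There is no binary linear [836, 11, 416] code: every `ZMod 2`-linear subspace of
`Fin 836 → ZMod 2` of dimension 11 contains a nonzero codeword of Hamming weight
at most 415. -/
theorem no_binary_linear_code_836_11_416
    (C : Submodule (ZMod 2) (Fin 836 → ZMod 2))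
    (hdim : Module.finrank (ZMod 2) C = 11) :
    ∃ c ∈ C, c ≠ 0 ∧ hammingNorm c ≤ 415 := by
  by_contra! hC
  let e : V ≃ₗ[ZMod 2] C := LinearEquiv.ofFinrankEq _ _ (by rw [hdim]; simp)
  let X : Fin 836 → V := fun i j => (e (Pi.single j 1) : Fin 836 → ZMod 2) i
  have hX : ∀ (i : Fin 836) (c : V), X i ⬝ᵥ c = (e c : Fin 836 → ZMod 2) i := by
    intro i c
    have hc : c = ∑ j, c j • (Pi.single j 1 : V) := by
      simpa using (pi_eq_sum_univ' c)
    conv_rhs => rw [hc]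
    simp only [map_sum, map_smul, Submodule.coe_sum, Submodule.coe_smul, Finset.sum_apply,
      Pi.smul_apply, smul_eq_mul, dotProduct, X]
    exact Finset.sum_congr rfl fun j _ => mul_comm _ _
  let f : V → ℕ := fun x => (Finset.univ.filter fun i => X i = x).card
  have hfsum : ∀ G : V → ℤ, ∑ x, (f x : ℤ) * G x = ∑ i, G (X i) := by
    intro G
    have h1 : ∀ x, (f x : ℤ) * G x = ∑ i, if X i = x then G x else 0 := by
      intro x
      rw [← Finset.sum_filter, Finset.sum_const, nsmul_eq_mul]
    simp only [h1]
    rw [Finset.sum_comm]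
    simp
  let g : V → ℤ := fun x => 13 - 32 * (f x : ℤ) + (if x = 0 then 128 else 0)
  have hhat : ∀ c, hat g c = 13 * (if c = 0 then 2048 else 0)
      - 32 * (836 - 2 * (hammingNorm (e c : Fin 836 → ZMod 2) : ℤ)) + 128 := by
    intro c
    have h1 : ∀ x, g x * sg (x ⬝ᵥ c) = 13 * sg (c ⬝ᵥ x) - 32 * ((f x : ℤ) * sg (x ⬝ᵥ c))
        + (if x = 0 then 128 * sg (x ⬝ᵥ c) else 0) := by
      intro x
      simp only [g]
      rw [dotProduct_comm c x]
      split_ifs <;> ring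
    unfold hat
    simp only [h1, Finset.sum_add_distrib, Finset.sum_sub_distrib, ← Finset.mul_sum, sum_sg]
    rw [hfsum (fun x => sg (x ⬝ᵥ c))]
    simp only [hX, sg_sum]
    rw [Finset.sum_ite_eq' Finset.univ (0 : V), if_pos (Finset.mem_univ _), zero_dotProduct,
      sg_zero, mul_one]
  have hnn : ∀ c, 0 ≤ hat g c := by
    intro c
    rw [hhat]
    by_cases hc : c = 0
    · subst hc
      simp
    · have h0 : (e c : Fin 836 → ZMod 2) ≠ 0 := by
        intro h
        apply hc
        apply e.injective
        rw [map_zero]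
        exact Subtype.ext h
      have := hC _ (e c).2 h0
      rw [if_neg hc]
      omega
  have hpos := cube_sum g hnn
  have hle : ∀ x, g x ^ 3 ≤ 2197 - 9056 * ((f x : ℤ) * 1) + (if x = 0 then 2801024 else 0) := by
    intro x
    simp only [g]
    split_ifs with h
    · have := cubic_bound0 (f x)
      ring_nf at this ⊢
      linarith
    · have := cubic_bound (f x)
      rw [add_zero, add_zero, mul_one]
      exact this
  have hs := Finset.sum_le_sum fun x (_ : x ∈ Finset.univ) => hle x
  rw [Finset.sum_add_distrib, Finset.sum_sub_distrib, ← Finset.mul_sum,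
    hfsum (fun _ => 1)] at hs
  simp at hs
  omega
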